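/- arXiv:1804.03171 — 2 statements merged into one kernel-verified Lean document; each statement's English description precedes it below -/
import Mathlib

section
/- Consider the inverse-problem setting with exact coefficient c satisfying c(x) ≥ 0 on Ω, exact solution u, and f satisfying condition (7), and the iterative process started from the initial approximation (16), with sufficiently smooth iterates u^k and coefficients c^k. Then for every k ≥ 0, the errors satisfy u^k(x,t) − u(x,t) ≤ 0 for all x ∈ Ω, 0 < t ≤ T, and c^k(x) − c(x) ≥ 0 for all x ∈ Ω. -/
noncomputable section

/-- The plane `ℝ²`. -/
abbrev E2 : Type := EuclideanSpace ℝ (Fin 2)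

/-- The elliptic operator `(A v)(x) = - div (k(x) grad v(x))`. -/
def ellOp (k : E2 → ℝ) (v : E2 → ℝ) (x : E2) : ℝ :=
  - ∑ i : Fin 2, fderiv ℝ (fun y => k y • gradient v y) x (EuclideanSpace.single i 1) i

/-- `u` solves the direct problem on `Ω × (0,T]` with diffusion coefficient `k`,
Robin boundary coefficient `μ`, reaction coefficient `c` and right-hand side `f`:
the parabolic equation, the homogeneous initial condition and the homogeneous
Robin (third-kind) boundary condition with respect to any outward unit normal. -/
structure IsDirectSolution (Ω : Set E2) (T : ℝ) (k μ : E2 → ℝ)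
    (c : E2 → ℝ) (f : E2 → ℝ → ℝ) (u : E2 → ℝ → ℝ) : Prop where
  pde : ∀ x ∈ Ω, ∀ t : ℝ, 0 < t → t ≤ T →
    deriv (u x) t + ellOp k (fun y => u y t) x + c x * u x t = f x t
  ic : ∀ x ∈ Ω, u x 0 = 0
  robin : ∀ x ∈ frontier Ω, ∀ ν : E2, ‖ν‖ = 1 →
    (∀ y ∈ closure Ω, (inner ℝ ν (y - x) : ℝ) ≤ 0) →
    ∀ t : ℝ, 0 < t → t ≤ T →
      k x * fderiv ℝ (fun y => u y t) x ν + μ x * u x t = 0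

/-- directional derivative -/
def dd (a : E2 × ℝ) (V : E2 × ℝ → ℝ) : E2 × ℝ → ℝ := fun p => fderiv ℝ V p a

abbrev Smooth (V : E2 × ℝ → ℝ) : Prop := ContDiff ℝ (⊤ : ℕ∞) V

abbrev ee (i : Fin 2) : E2 := EuclideanSpace.single i 1

/-- expanded elliptic operator -/
def LL (k : E2 → ℝ) (V : E2 × ℝ → ℝ) (x : E2) (t : ℝ) : ℝ :=
  - ∑ i : Fin 2, (fderiv ℝ k x (ee i) * dd (ee i, 0) V (x, t)
      + k x * dd (ee i, 0) (dd (ee i, 0) V) (x, t))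

lemma Smooth.diff {V : E2 × ℝ → ℝ} (h : Smooth V) : Differentiable ℝ V :=
  ContDiff.differentiable h (by simp)

lemma smooth_dd {V : E2 × ℝ → ℝ} (h : Smooth V) (a : E2 × ℝ) : Smooth (dd a V) := by
  unfold dd
  exact ContDiff.clm_apply (ContDiff.fderiv_right (m := ((⊤ : ℕ∞) : WithTop ℕ∞)) h (by simp)) contDiff_const

lemma dd_comm {V : E2 × ℝ → ℝ} (h : Smooth V) (a b : E2 × ℝ) :
    dd a (dd b V) = dd b (dd a V) := by
  have key : ∀ a b p, dd a (dd b V) p = fderiv ℝ (fderiv ℝ V) p a b := by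
    intro a b p
    unfold dd
    have hd : DifferentiableAt ℝ (fderiv ℝ V) p :=
      (ContDiff.differentiable (n := ((⊤ : ℕ∞) : WithTop ℕ∞))
        (ContDiff.fderiv_right (m := ((⊤ : ℕ∞) : WithTop ℕ∞)) h (by simp)) (by simp)) p
    rw [fderiv_clm_apply hd (differentiableAt_const b)]
    simp
  funext p
  rw [key, key]
  have hs : IsSymmSndFDerivAt ℝ V p := by
    apply ContDiffAt.isSymmSndFDerivAt (n := ((⊤ : ℕ∞) : WithTop ℕ∞)) (ContDiff.contDiffAt h)
    rw [minSmoothness_of_isRCLikeNormedField]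
    exact WithTop.coe_le_coe.2 (le_top : (2 : ℕ∞) ≤ ⊤)
  exact hs a b

lemma dd_add {V W : E2 × ℝ → ℝ} (hV : Smooth V) (hW : Smooth W) (a : E2 × ℝ) (r : ℝ) :
    dd a (fun p => V p + r * W p) = fun p => dd a V p + r * dd a W p := by
  funext p
  unfold dd
  rw [fderiv_fun_add (hV.diff p) ((hW.diff p).const_mul r), fderiv_const_mul (hW.diff p)]
  simp

lemma LL_add {V W : E2 × ℝ → ℝ} (hV : Smooth V) (hW : Smooth W) (r : ℝ) (k : E2 → ℝ) (x : E2)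
    (t : ℝ) : LL k (fun p => V p + r * W p) x t = LL k V x t + r * LL k W x t := by
  unfold LL
  simp only [dd_add hV hW, dd_add (smooth_dd hV _) (smooth_dd hW _), Fin.sum_univ_two]
  ring

lemma space_hasFDerivAt {V : E2 × ℝ → ℝ} (hV : Smooth V) (x : E2) (t : ℝ) :
    HasFDerivAt (fun y => V (y, t))
      ((fderiv ℝ V (x, t)).comp (ContinuousLinearMap.inl ℝ E2 ℝ)) x := by
  have h1 : HasFDerivAt (fun y : E2 => (y, t)) (ContinuousLinearMap.inl ℝ E2 ℝ) x := by
    exact hasFDerivAt_prodMk_left x t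
  exact (hV.diff (x, t)).hasFDerivAt.comp x h1

lemma space_fderiv {V : E2 × ℝ → ℝ} (hV : Smooth V) (x : E2) (t : ℝ) (e : E2) :
    fderiv ℝ (fun y => V (y, t)) x e = dd (e, 0) V (x, t) := by
  rw [(space_hasFDerivAt hV x t).fderiv]; rfl

lemma line_hasDerivAt {V : E2 × ℝ → ℝ} (hV : Smooth V) (p a : E2 × ℝ) (s : ℝ) :
    HasDerivAt (fun s => V (p + s • a)) (dd a V (p + s • a)) s := by
  have h1 : HasDerivAt (fun s : ℝ => p + s • a) a s := by
    simpa using ((hasDerivAt_id s).smul_const a).const_add p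
  exact (hV.diff (p + s • a)).hasFDerivAt.comp_hasDerivAt s h1

lemma time_hasDerivAt {V : E2 × ℝ → ℝ} (hV : Smooth V) (x : E2) (t : ℝ) :
    HasDerivAt (fun s => V (x, s)) (dd (0, 1) V (x, t)) t := by
  simpa using line_hasDerivAt hV (x, 0) (0, 1) t

lemma ellOp_eq {k : E2 → ℝ} {V : E2 × ℝ → ℝ} (hV : Smooth V) (x : E2) (t : ℝ)
    (hk : DifferentiableAt ℝ k x) : ellOp k (fun y => V (y, t)) x = LL k V x t := by
  unfold ellOp LL
  congr 1
  refine Finset.sum_congr rfl fun i _ => ?_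
  have hg : ∀ y, gradient (fun y => V (y, t)) y i = dd (ee i, 0) V (y, t) := by
    intro y
    rw [← space_fderiv hV, ← InnerProductSpace.toDual_symm_apply (𝕜 := ℝ),
      EuclideanSpace.inner_single_right]
    simp [gradient]
  have hgd : DifferentiableAt ℝ (gradient (fun y => V (y, t))) x := by
    rw [differentiableAt_euclidean]
    intro j
    have : (fun y => gradient (fun y => V (y, t)) y j) = fun y => dd (EuclideanSpace.single j 1, 0) V (y, t) := by
      funext y
      rw [← space_fderiv hV, ← InnerProductSpace.toDual_symm_apply (𝕜 := ℝ),
        EuclideanSpace.inner_single_right]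
      simp [gradient]
    rw [this]
    exact (space_hasFDerivAt (smooth_dd hV _) x t).differentiableAt
  have hF : DifferentiableAt ℝ (fun y => k y • gradient (fun y => V (y, t)) y) x := hk.smul hgd
  have h2 := ((EuclideanSpace.proj i : E2 →L[ℝ] ℝ).hasFDerivAt.comp x
    hF.hasFDerivAt).fderiv
  have h3 : ((EuclideanSpace.proj i : E2 →L[ℝ] ℝ) ∘
      fun y => k y • gradient (fun y => V (y, t)) y) = fun y => k y * dd (ee i, 0) V (y, t) := by
    funext y
    simp [← hg]
  rw [h3] at h2
  have h4 := congrArg (fun L => L (ee i)) h2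
  simp only [ContinuousLinearMap.comp_apply] at h4
  have h5 := (space_hasFDerivAt (smooth_dd hV (ee i, 0)) x t)
  rw [fderiv_fun_mul hk h5.differentiableAt] at h4
  simp only [ContinuousLinearMap.add_apply, ContinuousLinearMap.smul_apply,
    space_fderiv (smooth_dd hV _), smul_eq_mul] at h4
  change _ = fderiv ℝ (fun y => k y • gradient (fun y => V (y, t)) y) x (ee i) i at h4
  rw [← h4]; ring

lemma LL_time {k : E2 → ℝ} {V : E2 × ℝ → ℝ} (hV : Smooth V) (x : E2) (t : ℝ) :
    HasDerivAt (fun s => LL k V x s) (LL k (dd (0, 1) V) x t) t := by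
  have : LL k (dd (0, 1) V) x t = - ∑ i : Fin 2, (fderiv ℝ k x (ee i) *
      dd (0, 1) (dd (ee i, 0) V) (x, t) + k x * dd (0, 1) (dd (ee i, 0) (dd (ee i, 0) V)) (x, t)) := by
    unfold LL
    congr 1
    refine Finset.sum_congr rfl fun i _ => ?_
    rw [dd_comm hV (0, 1), dd_comm (smooth_dd hV _) (0, 1), dd_comm hV (0, 1)]
  rw [this]
  unfold LL
  refine HasDerivAt.neg (HasDerivAt.fun_sum fun i _ => ?_)
  exact ((time_hasDerivAt (smooth_dd hV _) x t).const_mul _).add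
    ((time_hasDerivAt (smooth_dd (smooth_dd hV _) _) x t).const_mul _)

/-- second derivative test, necessary direction -/
lemma second_nonneg {V : E2 × ℝ → ℝ} (hV : Smooth V) (p a : E2 × ℝ)
    (h : IsLocalMin (fun s : ℝ => V (p + s • a)) 0) : 0 ≤ dd a (dd a V) p := by
  by_contra hneg
  push Not at hneg
  have h1 : deriv (fun s : ℝ => V (p + s • a)) = fun s => dd a V (p + s • a) := by
    funext s; exact (line_hasDerivAt hV p a s).deriv
  have h2 : deriv (deriv (fun s : ℝ => V (p + s • a))) = fun s => dd a (dd a V) (p + s • a) := by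
    rw [h1]; funext s; exact (line_hasDerivAt (smooth_dd hV a) p a s).deriv
  have h3 : IsLocalMax (fun s : ℝ => V (p + s • a)) 0 :=
    isLocalMax_of_deriv_deriv_neg (by rw [h2]; simpa using hneg) h.deriv_eq_zero
      (line_hasDerivAt hV p a 0).continuousAt
  have h4 : (fun s : ℝ => V (p + s • a)) =ᶠ[nhds 0] fun _ => V (p + (0:ℝ) • a) := by
    filter_upwards [h, h3] with s hs1 hs2
    exact le_antisymm hs2 hs1
  have h5 := h4.deriv.deriv_eq
  rw [h2] at h5
  simp at h5
  linarith

lemma eq_zero_deriv {G : ℝ → ℝ} {G' t T : ℝ} (h : HasDerivAt G G' t)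
    (hz : ∀ s, 0 < s → s ≤ T → G s = 0) (ht : 0 < t) (htT : t ≤ T) : G' = 0 := by
  have h1 : HasDerivWithinAt G 0 (Set.Ioc 0 T) t :=
    (hasDerivWithinAt_const t (Set.Ioc 0 T) (0:ℝ)).congr (fun s hs => hz s hs.1 hs.2) (hz t ht htT)
  exact UniqueDiffWithinAt.eq_deriv _ (uniqueDiffOn_Ioc 0 T t ⟨ht, htT⟩) h.hasDerivWithinAt h1

lemma eq_zero_zero {G : ℝ → ℝ} {T : ℝ} (h : Continuous G) (hT : 0 < T)
    (hz : ∀ s, 0 < s → s ≤ T → G s = 0) : G 0 = 0 := by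
  have hs : Set.EqOn G (fun _ => 0) (Set.Ioc 0 T) := fun s hs => hz s hs.1 hs.2
  have := hs.closure h continuous_const
  rw [closure_Ioc hT.ne] at this
  exact this ⟨le_rfl, hT.le⟩

lemma maxPrinciple
    (Ω : Set E2) (hΩo : IsOpen Ω) (hΩb : Bornology.IsBounded Ω) (hΩconv : Convex ℝ Ω)
    (T : ℝ)
    (k μ : E2 → ℝ) (hkpos : ∀ x ∈ closure Ω, 0 < k x)
    (hkC1 : ContDiffOn ℝ 1 k (closure Ω))
    (hμ : ∀ x ∈ frontier Ω, 0 ≤ μ x)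
    (c : E2 → ℝ) (hc : ∀ x ∈ Ω, 0 ≤ c x)
    (W : E2 × ℝ → ℝ) (hW : Smooth W)
    (pde : ∀ x ∈ Ω, ∀ t : ℝ, 0 < t → t ≤ T →
      0 ≤ dd (0, 1) W (x, t) + LL k W x t + c x * W (x, t))
    (ic : ∀ x ∈ Ω, 0 ≤ W (x, 0))
    (robin : ∀ x ∈ frontier Ω, ∀ ν : E2, ‖ν‖ = 1 →
      (∀ y ∈ closure Ω, (inner ℝ ν (y - x) : ℝ) ≤ 0) →
      ∀ t : ℝ, 0 < t → t ≤ T → k x * dd (ν, 0) W (x, t) + μ x * W (x, t) = 0) :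
    ∀ x ∈ Ω, ∀ t : ℝ, 0 ≤ t → t ≤ T → 0 ≤ W (x, t) := by
  intro p hp t₁ ht₁ ht₁T
  by_contra hneg
  push Not at hneg
  have hcomp : IsCompact (closure Ω) := hΩb.isCompact_closure
  have hcl : ∀ x ∈ Ω, closure Ω ∈ nhds x := fun x hx =>
    Filter.mem_of_superset (hΩo.mem_nhds hx) subset_closure
  -- bound
  obtain ⟨M, hM0, hM⟩ : ∃ M : ℝ, 0 ≤ M ∧ ∀ x ∈ Ω,
      ∑ i : Fin 2, (fderiv ℝ k x (ee i) * (2 * inner ℝ (x - p) (ee i)) + k x * 2) < M := by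
    have hcd : ContinuousOn (fderivWithin ℝ k (closure Ω)) (closure Ω) :=
      hkC1.continuousOn_fderivWithin (uniqueDiffOn_convex hΩconv.closure
        ⟨p, mem_interior_iff_mem_nhds.2 (hcl p hp)⟩) le_rfl
    have hkc := hkC1.continuousOn
    have hcont : ContinuousOn (fun x => ∑ i : Fin 2, (fderivWithin ℝ k (closure Ω) x (ee i) *
        (2 * inner ℝ (x - p) (ee i)) + k x * 2)) (closure Ω) := by
      refine continuousOn_finsetSum _ fun i _ => ?_
      refine ContinuousOn.add (ContinuousOn.mul (hcd.clm_apply continuousOn_const) ?_)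
        (hkc.mul continuousOn_const)
      fun_prop
    obtain ⟨B, hB⟩ := (hcomp.bddAbove_image hcont)
    refine ⟨max 0 (B + 1), le_max_left _ _, fun x hx => ?_⟩
    have := hB ⟨x, subset_closure hx, rfl⟩
    simp only [fderivWithin_of_mem_nhds (hcl x hx)] at this
    exact lt_of_lt_of_le (by linarith) (le_max_right _ _)
  let Φ : E2 × ℝ → ℝ := fun q => inner ℝ (q.1 - p) (q.1 - p) + M * q.2
  have hΦ : Smooth Φ := by
    refine ContDiff.add ?_ (contDiff_const.mul contDiff_snd)
    exact (contDiff_fst.sub contDiff_const).inner ℝ (contDiff_fst.sub contDiff_const)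
  have hdΦ : ∀ e s, dd (e, s) Φ = fun q => 2 * inner ℝ (q.1 - p) e + M * s := by
    intro e s
    funext q
    have h1 := line_hasDerivAt hΦ q (e, s) 0
    have hl : HasDerivAt (fun s : ℝ => q.1 + s • e - p) e 0 := by
      simpa using (((hasDerivAt_id (0:ℝ)).smul_const e).const_add q.1).sub_const p
    have h2 : HasDerivAt (fun r : ℝ => Φ (q + r • (e, s)))
        (2 * inner ℝ (q.1 - p) e + M * s) 0 := by
      have h3 := (hl.inner ℝ hl).add ((((hasDerivAt_id (0:ℝ)).mul_const s).const_add q.2).const_mul M)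
      refine h3.congr_deriv ?_
      rw [zero_smul, add_zero, real_inner_comm (q.1 - p) e]
      ring
    have := h1.unique h2
    simpa using this
  have hddΦ : ∀ i, dd (ee i, 0) (dd (ee i, 0) Φ) = fun _ => 2 := by
    intro i
    funext q
    have hs := smooth_dd hΦ (ee i, 0)
    have h1 := line_hasDerivAt hs q (ee i, 0) 0
    have h2 : HasDerivAt (fun r : ℝ => dd (ee i, 0) Φ (q + r • (ee i, 0))) 2 0 := by
      rw [hdΦ]
      have hl : HasDerivAt (fun s : ℝ => q.1 + s • ee i - p) (ee i) 0 := by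
        simpa using (((hasDerivAt_id (0:ℝ)).smul_const (ee i)).const_add q.1).sub_const p
      have h3 := ((hl.inner ℝ (hasDerivAt_const (0:ℝ) (ee i))).const_mul 2).add_const (M * 0)
      refine h3.congr_deriv ?_
      simp [ee]
    have := h1.unique h2
    simpa using this
  have hΦ0 : ∀ x t, 0 ≤ t → 0 ≤ Φ (x, t) := by
    intro x t ht
    have : (0:ℝ) ≤ inner ℝ (x - p) (x - p) := real_inner_self_nonneg
    have := mul_nonneg hM0 ht
    simp only [Φ]; linarith
  obtain ⟨ε, hε, hεn⟩ : ∃ ε : ℝ, 0 < ε ∧ W (p, t₁) + ε * Φ (p, t₁) < 0 := by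
    have h0 := hΦ0 p t₁ ht₁
    refine ⟨-W (p, t₁) / (2 * (Φ (p, t₁) + 1)), by apply div_pos <;> linarith, ?_⟩
    have : -W (p, t₁) / (2 * (Φ (p, t₁) + 1)) * Φ (p, t₁) ≤ -W (p, t₁) / 2 := by
      rw [div_mul_eq_mul_div, div_le_div_iff₀ (by linarith) (by norm_num)]
      nlinarith
    linarith
  let V : E2 × ℝ → ℝ := fun q => W q + ε * Φ q
  have hV : Smooth V := ContDiff.add hW (contDiff_const.mul hΦ)
  obtain ⟨⟨x₀, t₀⟩, ⟨hx₀, ht₀⟩, hmin⟩ := (hcomp.prod (isCompact_Icc (a := (0:ℝ)) (b := T))).exists_isMinOn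
    ⟨(p, t₁), subset_closure hp, ht₁, ht₁T⟩ hV.continuous.continuousOn
  have hmin' : ∀ x ∈ closure Ω, ∀ t, 0 ≤ t → t ≤ T → V (x₀, t₀) ≤ V (x, t) :=
    fun x hx t h1 h2 => hmin (⟨hx, h1, h2⟩ : (x, t) ∈ closure Ω ×ˢ Set.Icc 0 T)
  simp only at hx₀ ht₀
  have hV0 : V (x₀, t₀) < 0 := lt_of_le_of_lt (hmin' p (subset_closure hp) t₁ ht₁ ht₁T) hεn
  have hW0 : W (x₀, t₀) < 0 := by
    have := mul_nonneg hε.le (hΦ0 x₀ t₀ ht₀.1)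
    simp only [V] at hV0; linarith
  have ht₀pos : 0 < t₀ := by
    rcases ht₀.1.lt_or_eq with h | h
    · exact h
    · exfalso
      have : 0 ≤ W (x₀, 0) := by
        have hclosed : IsClosed {x : E2 | 0 ≤ W (x, 0)} :=
          isClosed_le continuous_const (hW.continuous.comp (by fun_prop))
        exact closure_minimal ic hclosed hx₀
      rw [← h] at hW0; linarith
  by_cases hin : x₀ ∈ Ω
  · -- interior
    have hloc : ∀ e : E2, IsLocalMin (fun s : ℝ => V ((x₀, t₀) + s • (e, (0:ℝ)))) 0 := by
      intro e
      have hc1 : Continuous (fun s : ℝ => x₀ + s • e) := by fun_prop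
      have : ∀ᶠ s in nhds (0:ℝ), x₀ + s • e ∈ Ω :=
        hc1.continuousAt.eventually_mem (by simpa using hΩo.mem_nhds hin)
      filter_upwards [this] with s hs
      simpa using hmin' _ (subset_closure hs) t₀ ht₀.1 ht₀.2
    have hd1 : ∀ e : E2, dd (e, 0) V (x₀, t₀) = 0 := by
      intro e
      have h1 := (hloc e).deriv_eq_zero
      rw [(line_hasDerivAt hV _ _ 0).deriv] at h1
      simpa using h1
    have hd2 : ∀ e : E2, 0 ≤ dd (e, 0) (dd (e, 0) V) (x₀, t₀) := fun e =>
      second_nonneg hV _ _ (hloc e)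
    have hLV : LL k V x₀ t₀ ≤ 0 := by
      unfold LL
      rw [neg_nonpos]
      refine Finset.sum_nonneg fun i _ => ?_
      rw [hd1, mul_zero, zero_add]
      exact mul_nonneg (hkpos _ hx₀).le (hd2 _)
    have hLΦ : -M < LL k Φ x₀ t₀ := by
      unfold LL
      simp only [hddΦ]
      simp only [hdΦ, mul_zero, add_zero]
      exact neg_lt_neg (hM x₀ hin)
    have hLadd : LL k V x₀ t₀ = LL k W x₀ t₀ + ε * LL k Φ x₀ t₀ := LL_add hW hΦ ε k x₀ t₀
    have htd : dd (0, 1) V (x₀, t₀) ≤ 0 := by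
      have h1 := time_hasDerivAt hV x₀ t₀
      have h2 : Filter.Tendsto (slope (fun s => V (x₀, s)) t₀) (nhdsWithin t₀ (Set.Iio t₀))
          (nhds (dd (0, 1) V (x₀, t₀))) :=
        (hasDerivAt_iff_tendsto_slope.1 h1).mono_left
          (nhdsWithin_mono _ fun s hs => ne_of_lt hs)
      refine le_of_tendsto h2 ?_
      filter_upwards [Ioo_mem_nhdsLT ht₀pos] with s hs
      rw [slope_def_field]
      have := hmin' x₀ hx₀ s hs.1.le (hs.2.le.trans ht₀.2)
      exact div_nonpos_of_nonneg_of_nonpos (by linarith) (by linarith [hs.2])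
    have htadd : dd (0, 1) V (x₀, t₀) = dd (0, 1) W (x₀, t₀) + ε * M := by
      have := congrFun (dd_add hW hΦ (0, 1) ε) (x₀, t₀)
      rw [hdΦ] at this
      simpa using this
    have hp1 := pde x₀ hin t₀ ht₀pos ht₀.2
    have hcw : c x₀ * W (x₀, t₀) ≤ 0 := mul_nonpos_of_nonneg_of_nonpos (hc _ hin) hW0.le
    have : ε * (-M) < ε * LL k Φ x₀ t₀ := mul_lt_mul_of_pos_left hLΦ hε
    linarith
  · -- boundary
    have hfr : x₀ ∈ frontier Ω := by
      rw [hΩo.frontier_eq]; exact ⟨hx₀, hin⟩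
    have hdir : ∀ y ∈ closure Ω, 0 ≤ dd (y - x₀, 0) V (x₀, t₀) := by
      intro y hy
      have h1 := line_hasDerivAt hV (x₀, t₀) (y - x₀, 0) 0
      have h2 : Filter.Tendsto (slope (fun s : ℝ => V ((x₀, t₀) + s • (y - x₀, (0:ℝ)))) 0)
          (nhdsWithin 0 (Set.Ioi 0)) (nhds (dd (y - x₀, 0) V (x₀, t₀))) := by
        have := (hasDerivAt_iff_tendsto_slope.1 h1).mono_left
          (nhdsWithin_mono (0:ℝ) (fun s (hs : s ∈ Set.Ioi 0) => ne_of_gt hs))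
        simpa using this
      refine ge_of_tendsto h2 ?_
      filter_upwards [Ioo_mem_nhdsGT (zero_lt_one (α := ℝ))] with s hs
      rw [slope_def_field]
      have hmem : x₀ + s • (y - x₀) ∈ closure Ω :=
        hΩconv.closure.add_smul_sub_mem hx₀ hy ⟨hs.1.le, hs.2.le⟩
      have := hmin' _ hmem t₀ ht₀.1 ht₀.2
      apply div_nonneg
      · simpa using this
      · linarith [hs.1]
    -- normal with nonpositive derivative
    obtain ⟨ν, hν0, hνn, hνd⟩ : ∃ ν : E2, ν ≠ 0 ∧
        (∀ y ∈ closure Ω, (inner ℝ ν (y - x₀) : ℝ) ≤ 0) ∧ dd (ν, 0) V (x₀, t₀) ≤ 0 := by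
      set ℓ : StrongDual ℝ E2 := (fderiv ℝ V (x₀, t₀)).comp (ContinuousLinearMap.inl ℝ E2 ℝ) with hℓ
      have hℓd : ∀ e, dd (e, 0) V (x₀, t₀) = ℓ e := fun e => rfl
      by_cases hz : ℓ = 0
      · obtain ⟨g, hg⟩ := geometric_hahn_banach_open_point hΩconv hΩo hin
        refine ⟨(InnerProductSpace.toDual ℝ E2).symm g, ?_, ?_, ?_⟩
        · intro h0
          have : g = 0 := by simpa using h0
          have h3 := hg p hp
          rw [this] at h3
          simp at h3
        · have hclosed : IsClosed {y : E2 | g y ≤ g x₀} := isClosed_le g.continuous continuous_const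
          intro y hy
          have : g y ≤ g x₀ := closure_minimal (fun a ha => (hg a ha).le) hclosed hy
          rw [InnerProductSpace.toDual_symm_apply, map_sub]; linarith
        · rw [hℓd, hz]; simp
      · refine ⟨-(InnerProductSpace.toDual ℝ E2).symm ℓ, by simpa using hz, ?_, ?_⟩
        · intro y hy
          rw [inner_neg_left, InnerProductSpace.toDual_symm_apply, ← hℓd]
          linarith [hdir y hy]
        · rw [hℓd, map_neg, ← InnerProductSpace.toDual_symm_apply (𝕜 := ℝ) (y := ℓ)]
          linarith [real_inner_self_nonneg (x := (InnerProductSpace.toDual ℝ E2).symm ℓ)]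
    obtain ⟨s, hs, hsΩ⟩ : ∃ s : ℝ, 0 < s ∧ p + s • ν ∈ Ω := by
      have hc1 : Continuous (fun s : ℝ => p + s • ν) := by fun_prop
      have h1 : ∀ᶠ s in nhds (0:ℝ), p + s • ν ∈ Ω :=
        hc1.continuousAt.eventually_mem (by simpa using hΩo.mem_nhds hp)
      have h2 : ∀ᶠ s in nhdsWithin (0:ℝ) (Set.Ioi 0), p + s • ν ∈ Ω := h1.filter_mono nhdsWithin_le_nhds
      obtain ⟨s, h3, h4⟩ := (h2.and self_mem_nhdsWithin).exists
      exact ⟨s, h4, h3⟩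
    have hνpos : 0 < inner ℝ (x₀ - p) ν := by
      have h1 := hνn _ (subset_closure hsΩ)
      have h2 : (inner ℝ ν (p + s • ν - x₀) : ℝ) = s * inner ℝ ν ν - inner ℝ (x₀ - p) ν := by
        rw [real_inner_comm ν (x₀ - p)]
        simp only [inner_sub_right, inner_add_right, inner_smul_right]
        ring
      have h3 : 0 < s * inner ℝ ν ν := mul_pos hs (real_inner_self_pos.2 hν0)
      linarith
    have hνV : dd (ν, 0) V (x₀, t₀) = dd (ν, 0) W (x₀, t₀) + ε * (2 * inner ℝ (x₀ - p) ν) := by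
      have := congrFun (dd_add hW hΦ (ν, 0) ε) (x₀, t₀)
      rw [hdΦ] at this
      simpa using this
    have hnrm : 0 < ‖ν‖ := norm_pos_iff.2 hν0
    have hrob := robin x₀ hfr (‖ν‖⁻¹ • ν) (by rw [norm_smul, norm_inv, norm_norm, inv_mul_cancel₀ hnrm.ne'])
      (fun y hy => by
        rw [inner_smul_left]
        exact mul_nonpos_of_nonneg_of_nonpos (by simp) (hνn y hy)) t₀ ht₀pos ht₀.2
    have hsc : dd (‖ν‖⁻¹ • ν, 0) W (x₀, t₀) = ‖ν‖⁻¹ * dd (ν, 0) W (x₀, t₀) := by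
      have : ((‖ν‖⁻¹ • ν, 0) : E2 × ℝ) = ‖ν‖⁻¹ • (ν, 0) := by simp
      unfold dd
      rw [this, map_smul, smul_eq_mul]
    have hWν : dd (ν, 0) W (x₀, t₀) < 0 := by
      have : 0 < ε * (2 * inner ℝ (x₀ - p) ν) := by positivity
      linarith
    rw [hsc] at hrob
    have h1 : k x₀ * (‖ν‖⁻¹ * dd (ν, 0) W (x₀, t₀)) < 0 :=
      mul_neg_of_pos_of_neg (hkpos _ hx₀) (mul_neg_of_pos_of_neg (inv_pos.2 hnrm) hWν)
    have h2 : μ x₀ * W (x₀, t₀) ≤ 0 := mul_nonpos_of_nonneg_of_nonpos (hμ _ hfr) hW0.le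
    linarith

/-- properties of the time derivative of a solution -/
lemma sol_dt {Ω : Set E2} (hΩo : IsOpen Ω) {T : ℝ} (hT : 0 < T) {k μ c : E2 → ℝ}
    (hk : ∀ x ∈ Ω, DifferentiableAt ℝ k x) {f u : E2 → ℝ → ℝ}
    (hf : Smooth (Function.uncurry f)) (hf0 : ∀ x ∈ Ω, f x 0 = 0)
    (hu : Smooth (Function.uncurry u)) (h : IsDirectSolution Ω T k μ c f u) :
    (∀ x ∈ Ω, ∀ t : ℝ, 0 < t → t ≤ T →
      dd (0, 1) (dd (0, 1) (Function.uncurry u)) (x, t) + LL k (dd (0, 1) (Function.uncurry u)) x t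
        + c x * dd (0, 1) (Function.uncurry u) (x, t) = deriv (f x) t) ∧
    (∀ x ∈ Ω, dd (0, 1) (Function.uncurry u) (x, 0) = 0) ∧
    (∀ x ∈ frontier Ω, ∀ ν : E2, ‖ν‖ = 1 →
      (∀ y ∈ closure Ω, (inner ℝ ν (y - x) : ℝ) ≤ 0) →
      ∀ t : ℝ, 0 < t → t ≤ T →
        k x * dd (ν, 0) (dd (0, 1) (Function.uncurry u)) (x, t)
          + μ x * dd (0, 1) (Function.uncurry u) (x, t) = 0) := by
  set U := Function.uncurry u with hU
  have hUd : ∀ x t, deriv (u x) t = dd (0, 1) U (x, t) := fun x t => (time_hasDerivAt hu x t).deriv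
  have hfd : ∀ x t, deriv (f x) t = dd (0, 1) (Function.uncurry f) (x, t) :=
    fun x t => (time_hasDerivAt hf x t).deriv
  have hG : ∀ x ∈ Ω, ∀ t, 0 < t → t ≤ T →
      dd (0, 1) U (x, t) + LL k U x t + c x * U (x, t) - Function.uncurry f (x, t) = 0 := by
    intro x hx t h1 h2
    have := h.pde x hx t h1 h2
    rw [hUd] at this
    have h3 := ellOp_eq hu x t (hk x hx)
    change ellOp k (fun y => u y t) x = _ at h3
    rw [h3] at this
    change _ + _ + c x * u x t - f x t = 0
    linarith
  have hGd : ∀ x t, HasDerivAt (fun t => dd (0, 1) U (x, t) + LL k U x t + c x * U (x, t)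
      - Function.uncurry f (x, t)) (dd (0, 1) (dd (0, 1) U) (x, t) + LL k (dd (0, 1) U) x t
      + c x * dd (0, 1) U (x, t) - dd (0, 1) (Function.uncurry f) (x, t)) t := by
    intro x t
    exact (((time_hasDerivAt (smooth_dd hu _) x t).add (LL_time hu x t)).add
      ((time_hasDerivAt hu x t).const_mul _)).sub (time_hasDerivAt hf x t)
  refine ⟨fun x hx t h1 h2 => ?_, fun x hx => ?_, fun x hx ν hν hn t h1 h2 => ?_⟩
  · have := eq_zero_deriv (hGd x t) (hG x hx) h1 h2
    rw [hfd]; linarith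
  · have h0 := eq_zero_zero (continuous_iff_continuousAt.2 fun t => (hGd x t).continuousAt) hT (hG x hx)
    have hz1 : ∀ y ∈ Ω, ∀ e : E2, dd (e, 0) U (y, 0) = 0 := by
      intro y hy e
      rw [← space_fderiv hu]
      have : (fun z => U (z, 0)) =ᶠ[nhds y] fun _ => (0:ℝ) := by
        filter_upwards [hΩo.mem_nhds hy] with z hz
        exact h.ic z hz
      rw [this.fderiv_eq]; simp
    have hz2 : ∀ e : E2, dd (e, 0) (dd (e, 0) U) (x, 0) = 0 := by
      intro e
      rw [← space_fderiv (smooth_dd hu _)]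
      have : (fun z => dd (e, 0) U (z, 0)) =ᶠ[nhds x] fun _ => (0:ℝ) := by
        filter_upwards [hΩo.mem_nhds hx] with z hz
        exact hz1 z hz e
      rw [this.fderiv_eq]; simp
    have hL : LL k U x 0 = 0 := by
      unfold LL
      simp [hz1 x hx, hz2]
    have hu0 : U (x, 0) = 0 := h.ic x hx
    have hff : Function.uncurry f (x, 0) = 0 := hf0 x hx
    rw [hL, hu0, hff] at h0
    linarith
  · have hd : HasDerivAt (fun t => k x * dd (ν, 0) U (x, t) + μ x * U (x, t))
        (k x * dd (0, 1) (dd (ν, 0) U) (x, t) + μ x * dd (0, 1) U (x, t)) t :=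
      ((time_hasDerivAt (smooth_dd hu _) x t).const_mul _).add
        ((time_hasDerivAt hu x t).const_mul _)
    rw [dd_comm hu]
    refine eq_zero_deriv hd (fun s hs1 hs2 => ?_) h1 h2
    have := h.robin x hx ν hν hn s hs1 hs2
    rw [← space_fderiv hu]
    exact this

/-- for the iterative process started from the initial approximation (16),
the errors satisfy `uᵏ - u ≤ 0` on `Ω × (0,T]` and `cᵏ - c ≥ 0` on `Ω`, for every `k ≥ 0`. -/
theorem errors_signed
    (Ω : Set E2) (hΩo : IsOpen Ω) (hΩb : Bornology.IsBounded Ω) (hΩconv : Convex ℝ Ω)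
    (T : ℝ) (hT : 0 < T)
    (k μ : E2 → ℝ) (k₁ k₂ : ℝ) (hk₁ : 0 < k₁)
    (hkbd : ∀ x ∈ closure Ω, k₁ ≤ k x ∧ k x ≤ k₂)
    (hkC1 : ContDiffOn ℝ 1 k (closure Ω))
    (hμ : ∀ x ∈ frontier Ω, 0 ≤ μ x)
    (f : E2 → ℝ → ℝ) (hf : ContDiff ℝ (⊤ : ℕ∞) (Function.uncurry f))
    (c : E2 → ℝ) (hc : ∀ x ∈ Ω, 0 ≤ c x)
    (u : E2 → ℝ → ℝ) (hureg : ContDiff ℝ (⊤ : ℕ∞) (Function.uncurry u))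
    (hu : IsDirectSolution Ω T k μ c f u)
    (hf0 : ∀ x ∈ Ω, f x 0 = 0)
    (hft : ∀ x ∈ Ω, ∀ t : ℝ, 0 ≤ t → t ≤ T → 0 < deriv (f x) t)
    (ψ : E2 → ℝ) (hψdef : ∀ x, ψ x = u x T) (hψpos : ∀ x ∈ Ω, 0 < ψ x)
    (cs : ℕ → E2 → ℝ) (us : ℕ → E2 → ℝ → ℝ)
    (hsol : ∀ n : ℕ, IsDirectSolution Ω T k μ (cs n) f (us n))
    (hregs : ∀ n : ℕ, ContDiff ℝ (⊤ : ℕ∞) (Function.uncurry (us n)))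
    (hiter : ∀ n : ℕ, ∀ x ∈ Ω,
      cs (n + 1) x * ψ x = - deriv (us n x) T - ellOp k ψ x + f x T)
    (hinit : ∀ x ∈ Ω, cs 0 x * ψ x = - ellOp k ψ x + f x T) :
    ∀ n : ℕ,
      (∀ x ∈ Ω, ∀ t : ℝ, 0 < t → t ≤ T → us n x t - u x t ≤ 0) ∧
        (∀ x ∈ Ω, 0 ≤ cs n x - c x) := by
  classical
  have hkd : ∀ x ∈ Ω, DifferentiableAt ℝ k x := fun x hx =>
    (hkC1.contDiffAt (Filter.mem_of_superset (hΩo.mem_nhds hx) subset_closure)).differentiableAt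
      (by simp)
  have hkpos : ∀ x ∈ closure Ω, 0 < k x := fun x hx => hk₁.trans_le (hkbd x hx).1
  obtain ⟨up, ui, ur⟩ := sol_dt hΩo hT hkd hf hf0 hureg hu
  have hUd : ∀ x t, deriv (u x) t = dd (0, 1) (Function.uncurry u) (x, t) :=
    fun x t => (time_hasDerivAt hureg x t).deriv
  have hUsd : ∀ n x t, deriv (us n x) t = dd (0, 1) (Function.uncurry (us n)) (x, t) :=
    fun n x t => (time_hasDerivAt (hregs n) x t).deriv
  have hWpos := maxPrinciple Ω hΩo hΩb hΩconv T k μ hkpos hkC1 hμ c hc _ (smooth_dd hureg (0, 1))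
    (fun x hx t h1 h2 => by rw [up x hx t h1 h2]; exact (hft x hx t h1.le h2).le)
    (fun x hx => (ui x hx).ge) ur
  have hcmp : ∀ n, (∀ x ∈ Ω, c x ≤ cs n x) → ∀ x ∈ Ω, ∀ t : ℝ, 0 ≤ t → t ≤ T →
      dd (0, 1) (Function.uncurry (us n)) (x, t) ≤ dd (0, 1) (Function.uncurry u) (x, t) := by
    intro n hn
    obtain ⟨sp, si, sr⟩ := sol_dt hΩo hT hkd hf hf0 (hregs n) (hsol n)
    have hs1 := smooth_dd hureg (0, 1)
    have hs2 := smooth_dd (hregs n) (0, 1)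
    have := maxPrinciple Ω hΩo hΩb hΩconv T k μ hkpos hkC1 hμ (cs n)
      (fun x hx => (hc x hx).trans (hn x hx))
      (fun q => dd (0, 1) (Function.uncurry u) q + (-1) * dd (0, 1) (Function.uncurry (us n)) q)
      (ContDiff.add hs1 (contDiff_const.mul hs2))
      (fun x hx t h1 h2 => by
        rw [LL_add hs1 hs2, dd_add hs1 hs2]
        have e1 := up x hx t h1 h2
        have e2 := sp x hx t h1 h2
        have e3 := mul_nonneg (sub_nonneg.2 (hn x hx)) (hWpos x hx t h1.le h2)
        simp only
        linarith)
      (fun x hx => by simp [ui x hx, si x hx])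
      (fun x hx ν hν hn t h1 h2 => by
        rw [dd_add hs1 hs2]
        have e1 := ur x hx ν hν hn t h1 h2
        have e2 := sr x hx ν hν hn t h1 h2
        simp only
        linarith)
    intro x hx t h1 h2
    have := this x hx t h1 h2
    linarith
  have hψ : ∀ x ∈ Ω, c x * ψ x = - deriv (u x) T - ellOp k ψ x + f x T := by
    intro x hx
    have h1 := hu.pde x hx T hT le_rfl
    have h2 : ψ = fun y => u y T := funext hψdef
    rw [h2]
    simp only
    linarith
  have hcs : ∀ n, ∀ x ∈ Ω, c x ≤ cs n x := by
    intro n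
    induction n with
    | zero =>
      intro x hx
      have h1 := hinit x hx
      have h2 := hψ x hx
      have h3 := hWpos x hx T hT.le le_rfl
      rw [hUd] at h2
      exact le_of_mul_le_mul_right (by linarith) (hψpos x hx)
    | succ n ih =>
      intro x hx
      have h1 := hiter n x hx
      have h2 := hψ x hx
      have h3 := hcmp n ih x hx T hT.le le_rfl
      rw [hUd] at h2
      rw [hUsd] at h1
      exact le_of_mul_le_mul_right (by linarith) (hψpos x hx)
  intro n
  refine ⟨fun x hx t h1 h2 => ?_, fun x hx => sub_nonneg.2 (hcs n x hx)⟩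
  have hd : ∀ s, HasDerivAt (fun s => u x s - us n x s) (dd (0, 1) (Function.uncurry u) (x, s)
      - dd (0, 1) (Function.uncurry (us n)) (x, s)) s := fun s =>
    (time_hasDerivAt hureg x s).sub (time_hasDerivAt (hregs n) x s)
  have hmono : MonotoneOn (fun s => u x s - us n x s) (Set.Icc 0 T) := by
    refine monotoneOn_of_deriv_nonneg (convex_Icc 0 T)
      (fun s _ => (hd s).continuousAt.continuousWithinAt)
      (fun s _ => (hd s).differentiableAt.differentiableWithinAt) fun s hs => ?_
    have hs' := interior_subset hs
    rw [(hd s).deriv]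
    exact sub_nonneg.2 (hcmp n (hcs n) x hx s hs'.1 hs'.2)
  have := hmono ⟨le_rfl, hT.le⟩ ⟨h1.le, h2⟩ h1.le
  simp only [hu.ic x hx, (hsol n).ic x hx] at this
  linarith

end
end

section
/- Consider the inverse-problem setting with exact coefficient c satisfying c(x) ≥ 0 on Ω, exact solution u, and f satisfying condition (7). Run the iterative process with the initial approximation c⁰(x) = 0, with sufficiently smooth iterates u^k and coefficients c^k, and suppose additionally that condition (13) holds: (A(u⁰(·,T) − ψ))(x) ≥ 0 for all x ∈ Ω. Then the iterative process is monotone from below: for every k ≥ 1, u(x,t) ≤ u^k(x,t) ≤ u^{k−1}(x,t) and c(x) ≥ c^k(x) ≥ c^{k−1}(x), for all x ∈ Ω and 0 < t ≤ T. -/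
noncomputable section

lemma aux_grad_coord (v : E2 → ℝ) (y : E2) (i : Fin 2) :
    gradient v y i = fderiv ℝ v y (EuclideanSpace.single i 1) := by
  have h : inner ℝ (gradient v y) (EuclideanSpace.single i (1:ℝ)) = fderiv ℝ v y (EuclideanSpace.single i 1) := by
    simp [gradient]
  rw [← h, EuclideanSpace.inner_single_right]
  simp

lemma aux_formula (k v : E2 → ℝ) (x : E2) (hk : DifferentiableAt ℝ k x) (hv : ContDiff ℝ 2 v) :
    ellOp k v x = - ∑ i : Fin 2,
      (k x * fderiv ℝ (fun y => fderiv ℝ v y (EuclideanSpace.single i 1)) x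
          (EuclideanSpace.single i 1)
        + fderiv ℝ k x (EuclideanSpace.single i 1) * fderiv ℝ v x (EuclideanSpace.single i 1)) := by
  have hfd : Differentiable ℝ (fderiv ℝ v) :=
    (hv.fderiv_right (m := 1) (by norm_num)).differentiable (by norm_num)
  have hgr : Differentiable ℝ (gradient v) := by
    unfold gradient
    exact (InnerProductSpace.toDual ℝ E2).symm.toContinuousLinearEquiv.differentiable.comp hfd
  unfold ellOp
  congr 1
  refine Finset.sum_congr rfl fun i _ => ?_
  have hF : DifferentiableAt ℝ (fun y => k y • gradient v y) x := hk.smul (hgr x)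
  have h1 := ((EuclideanSpace.proj i : E2 →L[ℝ] ℝ).hasFDerivAt.comp x hF.hasFDerivAt).fderiv
  have h2 : (⇑(EuclideanSpace.proj i : E2 →L[ℝ] ℝ) ∘ fun y => k y • gradient v y)
      = fun y => k y * fderiv ℝ v y (EuclideanSpace.single i 1) := by
    funext y
    simp [aux_grad_coord]
  rw [h2] at h1
  have hg : DifferentiableAt ℝ (fun y => fderiv ℝ v y (EuclideanSpace.single i (1:ℝ))) x :=
    (hfd x).clm_apply (differentiableAt_const _)
  have h3 := congrArg (fun L : E2 →L[ℝ] ℝ => L (EuclideanSpace.single i 1)) h1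
  rw [fderiv_fun_mul hk hg] at h3
  simp at h3
  rw [← h3]
  ring

lemma aux_lin (k v w : E2 → ℝ) (a : ℝ) (x : E2) (hk : DifferentiableAt ℝ k x)
    (hv : ContDiff ℝ 2 v) (hw : ContDiff ℝ 2 w) :
    ellOp k (fun y => v y + a * w y) x = ellOp k v x + a * ellOp k w x := by
  have hfv : Differentiable ℝ (fderiv ℝ v) :=
    (hv.fderiv_right (m := 1) (by norm_num)).differentiable (by norm_num)
  have hfw : Differentiable ℝ (fderiv ℝ w) :=
    (hw.fderiv_right (m := 1) (by norm_num)).differentiable (by norm_num)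
  have dv : Differentiable ℝ v := hv.differentiable (by norm_num)
  have dw : Differentiable ℝ w := hw.differentiable (by norm_num)
  have h1 : ∀ (y e : E2), fderiv ℝ (fun y => v y + a * w y) y e
      = fderiv ℝ v y e + a * fderiv ℝ w y e := by
    intro y e
    rw [fderiv_fun_add (dv y) ((dw y).const_mul a), fderiv_const_mul (dw y)]
    simp
  have h2 : ∀ (e : E2), fderiv ℝ (fun y => fderiv ℝ v y e + a * fderiv ℝ w y e) x e
      = fderiv ℝ (fun y => fderiv ℝ v y e) x e + a * fderiv ℝ (fun y => fderiv ℝ w y e) x e := by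
    intro e
    have d1 : DifferentiableAt ℝ (fun y => fderiv ℝ v y e) x :=
      (hfv x).clm_apply (differentiableAt_const _)
    have d2 : DifferentiableAt ℝ (fun y => fderiv ℝ w y e) x :=
      (hfw x).clm_apply (differentiableAt_const _)
    rw [fderiv_fun_add d1 (d2.const_mul a), fderiv_const_mul d2]
    simp
  rw [aux_formula k _ x hk (hv.add (contDiff_const.mul hw)), aux_formula k v x hk hv,
    aux_formula k w x hk hw]
  simp only [h1, h2, Fin.sum_univ_two]
  ring

lemma aux_second {g : ℝ → ℝ} (hg : ContDiff ℝ 2 g) (h : IsLocalMin g 0) :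
    0 ≤ deriv (deriv g) 0 := by
  by_contra hneg
  push Not at hneg
  have hmax := isLocalMax_of_deriv_deriv_neg hneg h.deriv_eq_zero hg.continuous.continuousAt
  have hc : g =ᶠ[nhds 0] fun _ => g 0 := by
    filter_upwards [h, hmax] with y h1 h2
    exact le_antisymm h2 h1
  have := hc.deriv.deriv_eq
  simp at this
  linarith

lemma aux_min_interior (k v : E2 → ℝ) (x : E2) (hk : DifferentiableAt ℝ k x) (hk0 : 0 ≤ k x)
    (hv : ContDiff ℝ 2 v) (h : IsLocalMin v x) : ellOp k v x ≤ 0 := by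
  have hfv : Differentiable ℝ (fderiv ℝ v) :=
    (hv.fderiv_right (m := 1) (by norm_num)).differentiable (by norm_num)
  have dv : Differentiable ℝ v := hv.differentiable (by norm_num)
  rw [aux_formula k v x hk hv, h.fderiv_eq_zero]
  have key : ∀ e : E2, 0 ≤ fderiv ℝ (fun y => fderiv ℝ v y e) x e := by
    intro e
    have hl : ∀ s : ℝ, HasDerivAt (fun s : ℝ => x + s • e) e s := by
      intro s
      simpa using ((hasDerivAt_id s).smul_const e).const_add x
    have hlc : ContDiff ℝ 2 (fun s : ℝ => x + s • e) := by fun_prop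
    have hmin : IsLocalMin (fun s : ℝ => v (x + s • e)) 0 := by
      have hc : Filter.Tendsto (fun s : ℝ => x + s • e) (nhds 0) (nhds x) := by
        have := hlc.continuous.tendsto 0
        simpa using this
      have := hc.eventually h
      simpa [IsLocalMin, IsMinFilter] using this
    have h2 := aux_second (hv.comp hlc) hmin
    have hd : deriv (v ∘ fun s : ℝ => x + s • e) = fun s => fderiv ℝ v (x + s • e) e := by
      funext s
      exact ((dv _).hasFDerivAt.comp_hasDerivAt s (hl s)).deriv
    rw [hd] at h2
    have d1 : DifferentiableAt ℝ (fun y => fderiv ℝ v y e) (x + (0:ℝ) • e) :=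
      (hfv _).clm_apply (differentiableAt_const _)
    have := (d1.hasFDerivAt.comp_hasDerivAt (0:ℝ) (hl 0)).deriv
    simp only [Function.comp_def] at this
    rw [this] at h2
    simpa using h2
  have a0 := mul_nonneg hk0 (key (EuclideanSpace.single 0 1))
  have a1 := mul_nonneg hk0 (key (EuclideanSpace.single 1 1))
  simp only [Fin.sum_univ_two, ContinuousLinearMap.zero_apply, mul_zero, add_zero]
  linarith

lemma aux_bar_fderiv (x0 y e : E2) :
    fderiv ℝ (fun y : E2 => 1 + ‖y - x0‖ ^ 2) y e = 2 * inner ℝ (y - x0) e := by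
  have h := (((hasFDerivAt_id y).sub_const x0).norm_sq).const_add 1
  have h' := h.fderiv
  simp only [id] at h'
  rw [h']
  simp [inner_sub_left]

lemma aux_bar_smooth (x0 : E2) : ContDiff ℝ 2 (fun y : E2 => 1 + ‖y - x0‖ ^ 2) :=
  contDiff_const.add ((contDiff_id.sub contDiff_const).norm_sq ℝ)

lemma aux_bar (Ω : Set E2) (hΩo : IsOpen Ω) (hΩb : Bornology.IsBounded Ω) (hΩconv : Convex ℝ Ω)
    (k : E2 → ℝ) (k₂ : ℝ) (hkbd : ∀ x ∈ closure Ω, k x ≤ k₂)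
    (hkC1 : ContDiffOn ℝ 1 k (closure Ω)) (x0 : E2) (hx0 : x0 ∈ Ω) :
    ∃ L : ℝ, 0 ≤ L ∧ ∀ x ∈ Ω, -L ≤ ellOp k (fun y => 1 + ‖y - x0‖ ^ 2) x := by
  have hcomp : IsCompact (closure Ω) := hΩb.isCompact_closure
  have hud : UniqueDiffOn ℝ (closure Ω) := by
    refine uniqueDiffOn_convex hΩconv.closure ⟨x0, ?_⟩
    exact interior_maximal subset_closure hΩo hx0
  obtain ⟨M, hM⟩ := hcomp.exists_bound_of_continuousOn
    (hkC1.continuousOn_fderivWithin hud (by norm_num))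
  obtain ⟨D, hD⟩ := hcomp.exists_bound_of_continuousOn
    (f := fun y : E2 => y - x0) (by fun_prop)
  have hM0 : 0 ≤ M := (norm_nonneg _).trans (hM x0 (subset_closure hx0))
  have hD0 : 0 ≤ D := (norm_nonneg _).trans (hD x0 (subset_closure hx0))
  refine ⟨|4 * k₂ + 4 * (M * D)|, abs_nonneg _, fun x hx => ?_⟩
  have hxc := subset_closure hx
  have hnh : closure Ω ∈ nhds x := Filter.mem_of_superset (hΩo.mem_nhds hx) subset_closure
  have hk : DifferentiableAt ℝ k x := (hkC1.contDiffAt hnh).differentiableAt (by norm_num)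
  rw [aux_formula k _ x hk (aux_bar_smooth x0)]
  simp only [aux_bar_fderiv]
  have h2 : ∀ e : E2, fderiv ℝ (fun y : E2 => 2 * inner ℝ (y - x0) e) x e = 2 * inner ℝ e e := by
    intro e
    have h := ((((hasFDerivAt_id x).sub_const x0).inner ℝ (hasFDerivAt_const e x)).const_mul 2).fderiv
    simp only [id] at h
    rw [h]
    simp
  have h3 : ∀ i : Fin 2, fderiv ℝ k x (EuclideanSpace.single i 1) *
      (2 * inner ℝ (x - x0) (EuclideanSpace.single i (1:ℝ))) ≤ 2 * (M * D) := by
    intro i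
    have hn : ‖(EuclideanSpace.single i (1:ℝ) : E2)‖ = 1 := by simp
    have b1 : |fderiv ℝ k x (EuclideanSpace.single i 1)| ≤ M := by
      have := (fderiv ℝ k x).le_opNorm (EuclideanSpace.single i 1)
      rw [hn, mul_one, ← fderivWithin_of_mem_nhds hnh] at this
      rw [← fderivWithin_of_mem_nhds hnh]
      exact this.trans (hM x hxc)
    have b2 : |inner ℝ (x - x0) (EuclideanSpace.single i (1:ℝ))| ≤ D := by
      have := abs_real_inner_le_norm (x - x0) (EuclideanSpace.single i (1:ℝ))
      rw [hn, mul_one] at this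
      exact this.trans (hD x hxc)
    have b3 := (le_abs_self _).trans ((abs_mul _ _).le.trans
      (mul_le_mul b1 b2 (abs_nonneg _) hM0))
    linarith
  have h30 := h3 0
  have h31 := h3 1
  have hkx := hkbd x hxc
  have := le_abs_self (4 * k₂ + 4 * (M * D))
  simp only [h2, Fin.sum_univ_two]
  have hi : ∀ i : Fin 2, inner ℝ (EuclideanSpace.single i (1:ℝ) : E2) (EuclideanSpace.single i (1:ℝ)) = (1:ℝ) := by
    intro i
    simp
  rw [hi, hi]
  linarith

/-- existence of an outward normal for which the directional derivative is nonpositive. -/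
lemma aux_normal (Ω : Set E2) (hΩo : IsOpen Ω) (hΩconv : Convex ℝ Ω) (x0 : E2)
    (hx0 : x0 ∈ Ω) (x : E2) (hx : x ∈ frontier Ω) (v : E2 → ℝ) (hv : Differentiable ℝ v)
    (hmin : IsMinOn v (closure Ω) x) :
    ∃ ν : E2, ‖ν‖ = 1 ∧ (∀ y ∈ closure Ω, (inner ℝ ν (y - x) : ℝ) ≤ 0) ∧
      fderiv ℝ v x ν ≤ 0 ∧ 0 < (inner ℝ (x - x0) ν : ℝ) := by
  have hxc : x ∈ closure Ω := frontier_subset_closure hx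
  suffices H : ∃ n : E2, n ≠ 0 ∧ (∀ y ∈ closure Ω, (inner ℝ n (y - x) : ℝ) ≤ 0) ∧
      fderiv ℝ v x n ≤ 0 by
    obtain ⟨n, hn, h1, h2⟩ := H
    have hnp : 0 < ‖n‖ := norm_pos_iff.mpr hn
    have hν : ∀ y ∈ closure Ω, (inner ℝ (‖n‖⁻¹ • n) (y - x) : ℝ) ≤ 0 := by
      intro y hy
      rw [real_inner_smul_left]
      exact mul_nonpos_of_nonneg_of_nonpos (inv_nonneg.mpr hnp.le) (h1 y hy)
    have hν1 : ‖‖n‖⁻¹ • n‖ = 1 := by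
      rw [norm_smul, norm_inv, norm_norm, inv_mul_cancel₀ hnp.ne']
    refine ⟨‖n‖⁻¹ • n, hν1, hν, ?_, ?_⟩
    · rw [map_smul, smul_eq_mul]
      exact mul_nonpos_of_nonneg_of_nonpos (inv_nonneg.mpr hnp.le) h2
    · obtain ⟨r, hr, hball⟩ := Metric.isOpen_iff.mp hΩo x0 hx0
      set ν := ‖n‖⁻¹ • n with hνdef
      have hm : x0 + (r / 2) • ν ∈ Ω := by
        apply hball
        rw [Metric.mem_ball, dist_eq_norm, add_sub_cancel_left, norm_smul, hν1,
          Real.norm_of_nonneg (by positivity)]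
        linarith
      have := hν _ (subset_closure hm)
      have e : x0 + (r / 2) • ν - x = (r / 2) • ν - (x - x0) := by abel
      rw [e, inner_sub_right, real_inner_smul_right, real_inner_self_eq_norm_sq, hν1] at this
      rw [real_inner_comm]
      nlinarith
  have hdir : ∀ y ∈ closure Ω, 0 ≤ fderiv ℝ v x (y - x) := by
    intro y hy
    have hseg : segment ℝ x y ⊆ closure Ω := hΩconv.closure.segment_subset hxc hy
    exact (hmin.localize).hasFDerivWithinAt_nonneg (hv x).hasFDerivAt.hasFDerivWithinAt
      (sub_mem_posTangentConeAt_of_segment_subset hseg)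
  have hgi : ∀ e, fderiv ℝ v x e = inner ℝ (gradient v x) e := by
    intro e
    simp [gradient]
  by_cases hg : gradient v x = 0
  · have hxn : x ∉ Ω := by
      rw [hΩo.frontier_eq] at hx
      exact hx.2
    obtain ⟨φ, hφ⟩ := geometric_hahn_banach_open_point hΩconv hΩo hxn
    have hφi : ∀ e, φ e = inner ℝ ((InnerProductSpace.toDual ℝ E2).symm φ) e := by
      intro e
      simp
    refine ⟨(InnerProductSpace.toDual ℝ E2).symm φ, ?_, ?_, ?_⟩
    · intro h0
      have := hφ x0 hx0
      rw [hφi x0, hφi x, h0] at this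
      simp at this
    · intro y hy
      rw [← hφi, map_sub, sub_nonpos]
      have hcl : closure Ω ⊆ {y | φ y ≤ φ x} :=
        closure_minimal (fun y hy => (hφ y hy).le) (isClosed_le φ.continuous continuous_const)
      exact hcl hy
    · rw [hgi, hg]
      simp
  · refine ⟨-gradient v x, neg_ne_zero.mpr hg, ?_, ?_⟩
    · intro y hy
      have := hdir y hy
      rw [hgi] at this
      rw [inner_neg_left]
      linarith
    · rw [hgi, inner_neg_right, neg_nonpos]
      exact real_inner_self_nonneg

lemma aux_slice {w : E2 → ℝ → ℝ} (hw : ContDiff ℝ 2 (Function.uncurry w)) (t : ℝ) :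
    ContDiff ℝ 2 (fun y => w y t) :=
  hw.comp (contDiff_id.prodMk contDiff_const)

lemma aux_slice_t {w : E2 → ℝ → ℝ} (hw : ContDiff ℝ 2 (Function.uncurry w)) (x : E2) :
    ContDiff ℝ 2 (w x) :=
  hw.comp (contDiff_const.prodMk contDiff_id)

/-- weak minimum principle -/
lemma aux_mp (Ω : Set E2) (hΩo : IsOpen Ω) (hΩb : Bornology.IsBounded Ω) (hΩconv : Convex ℝ Ω)
    (S : ℝ)
    (k μ : E2 → ℝ) (k₁ k₂ : ℝ) (hk₁ : 0 < k₁)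
    (hkbd : ∀ x ∈ closure Ω, k₁ ≤ k x ∧ k x ≤ k₂)
    (hkC1 : ContDiffOn ℝ 1 k (closure Ω))
    (hμ : ∀ x ∈ frontier Ω, 0 ≤ μ x)
    (c : E2 → ℝ) (hc : ∀ x ∈ Ω, 0 ≤ c x)
    (w : E2 → ℝ → ℝ) (hw : ContDiff ℝ 2 (Function.uncurry w))
    (hpde : ∀ x ∈ Ω, ∀ t : ℝ, 0 < t → t ≤ S →
      0 ≤ deriv (w x) t + ellOp k (fun y => w y t) x + c x * w x t)
    (hic : ∀ x ∈ Ω, 0 ≤ w x 0)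
    (hrob : ∀ x ∈ frontier Ω, ∀ ν : E2, ‖ν‖ = 1 →
      (∀ y ∈ closure Ω, (inner ℝ ν (y - x) : ℝ) ≤ 0) →
      ∀ t : ℝ, 0 < t → t ≤ S →
        k x * fderiv ℝ (fun y => w y t) x ν + μ x * w x t = 0) :
    ∀ x ∈ Ω, ∀ t : ℝ, 0 ≤ t → t ≤ S → 0 ≤ w x t := by
  intro x0 hx0 t0 ht0 ht0S
  obtain ⟨L, hL0, hL⟩ := aux_bar Ω hΩo hΩb hΩconv k k₂ (fun x hx => (hkbd x hx).2) hkC1 x0 hx0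
  set lam := L + 1 with hlam
  have main : ∀ ε : ℝ, 0 < ε →
      0 ≤ w x0 t0 + (ε * Real.exp (lam * t0)) * (1 + ‖x0 - x0‖ ^ 2) := by
    intro ε hε
    by_contra hneg
    push Not at hneg
    have hcomp : IsCompact (closure Ω ×ˢ Set.Icc (0:ℝ) S) :=
      hΩb.isCompact_closure.prod isCompact_Icc
    have hcont : Continuous (fun p : E2 × ℝ => w p.1 p.2 +
        (ε * Real.exp (lam * p.2)) * (1 + ‖p.1 - x0‖ ^ 2)) := by
      have : Continuous (fun p : E2 × ℝ => w p.1 p.2) := hw.continuous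
      fun_prop
    obtain ⟨⟨x, t⟩, ⟨hxc, ht⟩, hmin⟩ := hcomp.exists_isMinOn
      ⟨(x0, t0), subset_closure hx0, ht0, ht0S⟩ hcont.continuousOn
    simp only at hxc ht
    have hval : w x t + (ε * Real.exp (lam * t)) * (1 + ‖x - x0‖ ^ 2) < 0 :=
      lt_of_le_of_lt (hmin (show ((x0, t0) : E2 × ℝ) ∈ _ from ⟨subset_closure hx0, ht0, ht0S⟩)) hneg
    have hbpos : 0 < (1 + ‖x - x0‖ ^ 2) := by positivity
    set a := ε * Real.exp (lam * t) with ha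
    have hapos : 0 < a := by positivity
    have hwneg : w x t < 0 := by nlinarith [mul_pos hapos hbpos]
    have ht0' : 0 < t := by
      rcases ht.1.lt_or_eq with h | h
      · exact h
      · exfalso
        have hcl : closure Ω ⊆ {y | 0 ≤ w y 0} :=
          closure_minimal (fun y hy => hic y hy)
            (isClosed_le continuous_const (aux_slice hw 0).continuous)
        have := hcl hxc
        rw [← h] at hwneg
        exact absurd this (not_le.mpr hwneg)
    have hminx : IsMinOn (fun y => w y t + a * (1 + ‖y - x0‖ ^ 2)) (closure Ω) x := by
      intro y hy
      exact hmin (show ((y, t) : E2 × ℝ) ∈ _ from ⟨hy, ht⟩)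
    have hsl := aux_slice hw t
    have hsm : ContDiff ℝ 2 (fun y => w y t + a * (1 + ‖y - x0‖ ^ 2)) :=
      hsl.add (contDiff_const.mul (aux_bar_smooth x0))
    by_cases hx : x ∈ Ω
    · have hnh : closure Ω ∈ nhds x := Filter.mem_of_superset (hΩo.mem_nhds hx) subset_closure
      have hk : DifferentiableAt ℝ k x := (hkC1.contDiffAt hnh).differentiableAt (by norm_num)
      have hkx := (hkbd x hxc).1
      have h1 := aux_min_interior k _ x hk (by linarith) hsm (hminx.isLocalMin hnh)
      rw [aux_lin k _ _ a x hk hsl (aux_bar_smooth x0)] at h1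
      have hmint : IsMinOn (fun s => w x s + (ε * Real.exp (lam * s)) * (1 + ‖x - x0‖ ^ 2))
          (Set.Icc 0 S) t := by
        intro s hs
        exact hmin (show ((x, s) : E2 × ℝ) ∈ _ from ⟨hxc, hs⟩)
      have hdt : HasDerivAt (fun s => w x s + (ε * Real.exp (lam * s)) * (1 + ‖x - x0‖ ^ 2))
          (deriv (w x) t + a * lam * (1 + ‖x - x0‖ ^ 2)) t := by
        have d1 : HasDerivAt (w x) (deriv (w x) t) t :=
          ((aux_slice_t hw x).differentiable (by norm_num) t).hasDerivAt
        have d2 : HasDerivAt (fun s => Real.exp (lam * s)) (Real.exp (lam * t) * lam) t := by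
          have := ((hasDerivAt_id t).const_mul lam).exp
          simpa using this
        have e : deriv (w x) t + a * lam * (1 + ‖x - x0‖ ^ 2) = deriv (w x) t +
            ε * (Real.exp (lam * t) * lam) * (1 + ‖x - x0‖ ^ 2) := by
          rw [ha]
          ring
        rw [e]
        exact d1.add ((d2.const_mul ε).mul_const (1 + ‖x - x0‖ ^ 2))
      have hseg : segment ℝ t 0 ⊆ Set.Icc (0:ℝ) S :=
        (convex_Icc (0:ℝ) S).segment_subset ht ⟨le_rfl, ht.1.trans ht.2⟩
      have h2 := (hmint.localize).hasFDerivWithinAt_nonneg hdt.hasFDerivAt.hasFDerivWithinAt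
        (sub_mem_posTangentConeAt_of_segment_subset hseg)
      simp at h2
      have h2' : deriv (w x) t + a * lam * (1 + ‖x - x0‖ ^ 2) ≤ 0 := by
        by_contra hcon
        push Not at hcon
        nlinarith [mul_pos ht0' hcon]
      have h3 := hpde x hx t ht0' ht.2
      have h4 : c x * w x t ≤ 0 := mul_nonpos_of_nonneg_of_nonpos (hc x hx) hwneg.le
      have h5 := mul_le_mul_of_nonneg_left (hL x hx) hapos.le
      have h6 : a * lam ≤ a * lam * (1 + ‖x - x0‖ ^ 2) := by
        have : 0 ≤ a * lam := by positivity
        nlinarith [sq_nonneg ‖x - x0‖]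
      rw [hlam] at h6 h2'
      nlinarith
    · have hxf : x ∈ frontier Ω := by
        rw [hΩo.frontier_eq]
        exact ⟨hxc, hx⟩
      obtain ⟨ν, hν1, hνo, hν2, hν3⟩ := aux_normal Ω hΩo hΩconv x0 hx0 x hxf _
        (hsm.differentiable (by norm_num)) hminx
      rw [fderiv_fun_add (hsl.differentiable (by norm_num) x)
        (((aux_bar_smooth x0).differentiable (by norm_num) x).const_mul a),
        fderiv_const_mul ((aux_bar_smooth x0).differentiable (by norm_num) x)] at hν2
      simp only [ContinuousLinearMap.add_apply, ContinuousLinearMap.smul_apply, smul_eq_mul,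
        aux_bar_fderiv] at hν2
      have h1 := hrob x hxf ν hν1 hνo t ht0' ht.2
      have hkx := (hkbd x hxc).1
      have h2 : μ x * w x t ≤ 0 := mul_nonpos_of_nonneg_of_nonpos (hμ x hxf) hwneg.le
      have h3 : fderiv ℝ (fun y => w y t) x ν < 0 := by nlinarith [mul_pos hapos hν3]
      nlinarith
  by_contra hneg
  push Not at hneg
  have h := main (-(w x0 t0) / 2 * (Real.exp (lam * t0))⁻¹)
    (mul_pos (by linarith) (inv_pos.mpr (Real.exp_pos _)))
  rw [inv_mul_cancel_right₀ (Real.exp_pos _).ne'] at h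
  simp at h
  linarith

/-- nonnegativity and monotonicity in time -/
lemma aux_mono (Ω : Set E2) (hΩo : IsOpen Ω) (hΩb : Bornology.IsBounded Ω) (hΩconv : Convex ℝ Ω)
    (T : ℝ) (hT : 0 < T)
    (k μ : E2 → ℝ) (k₁ k₂ : ℝ) (hk₁ : 0 < k₁)
    (hkbd : ∀ x ∈ closure Ω, k₁ ≤ k x ∧ k x ≤ k₂)
    (hkC1 : ContDiffOn ℝ 1 k (closure Ω))
    (hμ : ∀ x ∈ frontier Ω, 0 ≤ μ x)
    (c : E2 → ℝ) (hc : ∀ x ∈ Ω, 0 ≤ c x)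
    (w : E2 → ℝ → ℝ) (hw : ContDiff ℝ 2 (Function.uncurry w))
    (g : E2 → ℝ → ℝ) (hg0 : ∀ x ∈ Ω, ∀ t, 0 ≤ t → t ≤ T → 0 ≤ g x t)
    (hgm : ∀ x ∈ Ω, MonotoneOn (g x) (Set.Icc 0 T))
    (h : IsDirectSolution Ω T k μ c g w) :
    (∀ x ∈ Ω, ∀ t : ℝ, 0 ≤ t → t ≤ T → 0 ≤ w x t) ∧
    (∀ x ∈ Ω, MonotoneOn (w x) (Set.Icc 0 T)) ∧ (∀ x ∈ Ω, 0 ≤ deriv (w x) T) := by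
  have hnn : ∀ x ∈ Ω, ∀ t : ℝ, 0 ≤ t → t ≤ T → 0 ≤ w x t := by
    refine aux_mp Ω hΩo hΩb hΩconv T k μ k₁ k₂ hk₁ hkbd hkC1 hμ c hc w hw ?_ ?_ h.robin
    · intro x hx t ht htT
      rw [h.pde x hx t ht htT]
      exact hg0 x hx t ht.le htT
    · intro x hx
      rw [h.ic x hx]
  have hmono : ∀ x ∈ Ω, MonotoneOn (w x) (Set.Icc 0 T) := by
    intro x hx s hs t ht hst
    set d := t - s with hd
    have hd0 : 0 ≤ d := by linarith
    have hsh : ContDiff ℝ 2 (Function.uncurry fun y r => w y (r + d)) :=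
      hw.comp (contDiff_fst.prodMk (contDiff_snd.add contDiff_const))
    have hdw : ∀ y r, DifferentiableAt ℝ (w y) r := fun y r =>
      (aux_slice_t hw y).differentiable (by norm_num) r
    have hdx : ∀ y r, DifferentiableAt ℝ (fun z => w z r) y := fun y r =>
      (aux_slice hw r).differentiable (by norm_num) y
    have := aux_mp Ω hΩo hΩb hΩconv (T - d) k μ k₁ k₂ hk₁ hkbd hkC1 hμ c hc
      (fun y r => w y (r + d) + (-1) * w y r) (hsh.add (contDiff_const.mul hw)) ?_ ?_ ?_
      x hx s hs.1 (by have := ht.2; linarith)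
    · have e : s + d = t := by rw [hd]; ring
      simp only [e] at this
      linarith
    · intro y hy r hr hrT
      have hnh : closure Ω ∈ nhds y := Filter.mem_of_superset (hΩo.mem_nhds hy) subset_closure
      have hk : DifferentiableAt ℝ k y := (hkC1.contDiffAt hnh).differentiableAt (by norm_num)
      rw [aux_lin k _ _ (-1) y hk (aux_slice hw (r + d)) (aux_slice hw r)]
      have hder : deriv (fun r => w y (r + d) + (-1) * w y r) r
          = deriv (w y) (r + d) + (-1) * deriv (w y) r :=
        (((hdw y (r + d)).hasDerivAt.comp_add_const r d).add
          ((hdw y r).hasDerivAt.const_mul (-1))).deriv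
      rw [hder]
      have p1 := h.pde y hy (r + d) (by linarith) (by linarith)
      have p2 := h.pde y hy r hr (by linarith)
      have p3 := hgm y hy (show r ∈ Set.Icc 0 T from ⟨hr.le, by linarith⟩)
        (show r + d ∈ Set.Icc 0 T from ⟨by linarith, by linarith⟩) (by linarith)
      linarith
    · intro y hy
      simp only [zero_add]
      rw [h.ic y hy]
      have := hnn y hy d hd0 (by have := ht.2; have := hs.1; linarith)
      linarith
    · intro y hy ν h1 h2 r hr hrT
      have p1 := h.robin y hy ν h1 h2 (r + d) (by linarith) (by linarith)
      have p2 := h.robin y hy ν h1 h2 r hr (by linarith)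
      rw [fderiv_fun_add (hdx y _) ((hdx y r).const_mul (-1)), fderiv_const_mul (hdx y r)]
      simp only [ContinuousLinearMap.add_apply, ContinuousLinearMap.smul_apply, smul_eq_mul]
      linarith
  refine ⟨hnn, hmono, fun x hx => ?_⟩
  have h1 := (hmono x hx).derivWithin_nonneg (x := T)
  have hd : DifferentiableAt ℝ (w x) T := (aux_slice_t hw x).differentiable (by norm_num) T
  rwa [hd.derivWithin (uniqueDiffOn_Icc hT T ⟨hT.le, le_rfl⟩)] at h1

/-- the difference of two direct solutions solves a direct problem -/
lemma aux_diff (Ω : Set E2) (hΩo : IsOpen Ω) (T : ℝ) (k μ : E2 → ℝ)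
    (hkC1 : ContDiffOn ℝ 1 k (closure Ω)) (f : E2 → ℝ → ℝ)
    (c₁ c₂ : E2 → ℝ) (u₁ u₂ : E2 → ℝ → ℝ)
    (hr₁ : ContDiff ℝ 2 (Function.uncurry u₁)) (hr₂ : ContDiff ℝ 2 (Function.uncurry u₂))
    (h₁ : IsDirectSolution Ω T k μ c₁ f u₁) (h₂ : IsDirectSolution Ω T k μ c₂ f u₂) :
    IsDirectSolution Ω T k μ c₂ (fun x t => (c₂ x - c₁ x) * u₁ x t)
      (fun x t => u₁ x t + (-1) * u₂ x t) := by
  refine ⟨?_, ?_, ?_⟩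
  · intro y hy r hr hrT
    have hnh : closure Ω ∈ nhds y := Filter.mem_of_superset (hΩo.mem_nhds hy) subset_closure
    have hk : DifferentiableAt ℝ k y := (hkC1.contDiffAt hnh).differentiableAt (by norm_num)
    rw [aux_lin k _ _ (-1) y hk (aux_slice hr₁ r) (aux_slice hr₂ r)]
    have hder : deriv (fun r => u₁ y r + (-1) * u₂ y r) r
        = deriv (u₁ y) r + (-1) * deriv (u₂ y) r :=
      (((aux_slice_t hr₁ y).differentiable (by norm_num) r).hasDerivAt.add
        (((aux_slice_t hr₂ y).differentiable (by norm_num) r).hasDerivAt.const_mul (-1))).deriv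
    rw [hder]
    have p1 := h₁.pde y hy r hr hrT
    have p2 := h₂.pde y hy r hr hrT
    linear_combination p1 - p2
  · intro x hx
    simp [h₁.ic x hx, h₂.ic x hx]
  · intro y hy ν h1 h2 r hr hrT
    have p1 := h₁.robin y hy ν h1 h2 r hr hrT
    have p2 := h₂.robin y hy ν h1 h2 r hr hrT
    have d1 := (aux_slice hr₁ r).differentiable (by norm_num) y
    have d2 := (aux_slice hr₂ r).differentiable (by norm_num) y
    rw [fderiv_fun_add d1 (d2.const_mul (-1)), fderiv_const_mul d2]
    simp only [ContinuousLinearMap.add_apply, ContinuousLinearMap.smul_apply, smul_eq_mul]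
    linear_combination p1 - p2

/-- the iterative process started from `c⁰ = 0`, under the additional
condition (13) `A(u⁰(·,T) - ψ) ≥ 0` on `Ω`, is monotone from below: for every `k ≥ 1`,
`u ≤ uᵏ ≤ uᵏ⁻¹` on `Ω × (0,T]` and `c ≥ cᵏ ≥ cᵏ⁻¹` on `Ω`. -/
theorem iteration_monotone_from_below
    (Ω : Set E2) (hΩo : IsOpen Ω) (hΩb : Bornology.IsBounded Ω) (hΩconv : Convex ℝ Ω)
    (T : ℝ) (hT : 0 < T)
    (k μ : E2 → ℝ) (k₁ k₂ : ℝ) (hk₁ : 0 < k₁)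
    (hkbd : ∀ x ∈ closure Ω, k₁ ≤ k x ∧ k x ≤ k₂)
    (hkC1 : ContDiffOn ℝ 1 k (closure Ω))
    (hμ : ∀ x ∈ frontier Ω, 0 ≤ μ x)
    (f : E2 → ℝ → ℝ) (hf : ContDiff ℝ (⊤ : ℕ∞) (Function.uncurry f))
    (c : E2 → ℝ) (hc : ∀ x ∈ Ω, 0 ≤ c x)
    (u : E2 → ℝ → ℝ) (hureg : ContDiff ℝ (⊤ : ℕ∞) (Function.uncurry u))
    (hu : IsDirectSolution Ω T k μ c f u)
    (hf0 : ∀ x ∈ Ω, f x 0 = 0)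
    (hft : ∀ x ∈ Ω, ∀ t : ℝ, 0 ≤ t → t ≤ T → 0 < deriv (f x) t)
    (ψ : E2 → ℝ) (hψdef : ∀ x, ψ x = u x T) (hψpos : ∀ x ∈ Ω, 0 < ψ x)
    (cs : ℕ → E2 → ℝ) (us : ℕ → E2 → ℝ → ℝ)
    (hsol : ∀ n : ℕ, IsDirectSolution Ω T k μ (cs n) f (us n))
    (hregs : ∀ n : ℕ, ContDiff ℝ (⊤ : ℕ∞) (Function.uncurry (us n)))
    (hiter : ∀ n : ℕ, ∀ x ∈ Ω,
      cs (n + 1) x * ψ x = - deriv (us n x) T - ellOp k ψ x + f x T)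
    (hinit0 : ∀ x ∈ Ω, cs 0 x = 0)
    (h13 : ∀ x ∈ Ω, 0 ≤ ellOp k (fun y => us 0 y T - ψ y) x) :
    ∀ n : ℕ, 1 ≤ n → ∀ x ∈ Ω,
      (∀ t : ℝ, 0 < t → t ≤ T → u x t ≤ us n x t ∧ us n x t ≤ us (n - 1) x t) ∧
        (cs n x ≤ c x ∧ cs (n - 1) x ≤ cs n x) := by
  have hureg2 : ContDiff ℝ 2 (Function.uncurry u) := hureg.of_le (WithTop.coe_le_coe.mpr le_top)
  have hregs2 : ∀ n, ContDiff ℝ 2 (Function.uncurry (us n)) :=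
    fun n => (hregs n).of_le (WithTop.coe_le_coe.mpr le_top)
  have hkd : ∀ y ∈ Ω, DifferentiableAt ℝ k y := fun y hy =>
    (hkC1.contDiffAt (Filter.mem_of_superset (hΩo.mem_nhds hy) subset_closure)).differentiableAt
      (by norm_num)
  have hψ : ψ = fun x => u x T := funext hψdef
  have hfm : ∀ x ∈ Ω, MonotoneOn (f x) (Set.Icc 0 T) := by
    intro x hx
    have hs : ContDiff ℝ (⊤ : ℕ∞) (f x) := hf.comp (contDiff_const.prodMk contDiff_id)
    refine monotoneOn_of_deriv_nonneg (convex_Icc 0 T) hs.continuous.continuousOn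
      (hs.differentiable (by simp)).differentiableOn ?_
    intro t ht
    rw [interior_Icc] at ht
    exact (hft x hx t ht.1.le ht.2.le).le
  have hfn : ∀ x ∈ Ω, ∀ t, 0 ≤ t → t ≤ T → 0 ≤ f x t := by
    intro x hx t ht htT
    have := hfm x hx ⟨le_rfl, hT.le⟩ ⟨ht, htT⟩ ht
    rwa [hf0 x hx] at this
  -- general comparison
  have comp : ∀ (c₁ c₂ : E2 → ℝ) (u₁ u₂ : E2 → ℝ → ℝ),
      ContDiff ℝ 2 (Function.uncurry u₁) → ContDiff ℝ 2 (Function.uncurry u₂) →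
      IsDirectSolution Ω T k μ c₁ f u₁ → IsDirectSolution Ω T k μ c₂ f u₂ →
      (∀ x ∈ Ω, 0 ≤ c₁ x) → (∀ x ∈ Ω, c₁ x ≤ c₂ x) →
      (∀ x ∈ Ω, ∀ t, 0 ≤ t → t ≤ T → u₂ x t ≤ u₁ x t) ∧
      (∀ x ∈ Ω, deriv (u₂ x) T ≤ deriv (u₁ x) T) := by
    intro c₁ c₂ u₁ u₂ hr₁ hr₂ h₁ h₂ hc₁ hc₁₂
    obtain ⟨a1, a2, -⟩ := aux_mono Ω hΩo hΩb hΩconv T hT k μ k₁ k₂ hk₁ hkbd hkC1 hμ c₁ hc₁ u₁ hr₁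
      f hfn hfm h₁
    obtain ⟨b1, -, b3⟩ := aux_mono Ω hΩo hΩb hΩconv T hT k μ k₁ k₂ hk₁ hkbd hkC1 hμ c₂
      (fun x hx => (hc₁ x hx).trans (hc₁₂ x hx)) _ (hr₁.add (contDiff_const.mul hr₂))
      _ (fun x hx t ht htT => mul_nonneg (sub_nonneg.mpr (hc₁₂ x hx)) (a1 x hx t ht htT))
      (fun x hx s hs t ht hst => mul_le_mul_of_nonneg_left (a2 x hx hs ht hst)
        (sub_nonneg.mpr (hc₁₂ x hx)))
      (aux_diff Ω hΩo T k μ hkC1 f c₁ c₂ u₁ u₂ hr₁ hr₂ h₁ h₂)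
    refine ⟨fun x hx t ht htT => ?_, fun x hx => ?_⟩
    · have := b1 x hx t ht htT
      linarith
    · have := b3 x hx
      have hder : deriv (fun r => u₁ x r + (-1) * u₂ x r) T
          = deriv (u₁ x) T + (-1) * deriv (u₂ x) T :=
        (((aux_slice_t hr₁ x).differentiable (by norm_num) T).hasDerivAt.add
          (((aux_slice_t hr₂ x).differentiable (by norm_num) T).hasDerivAt.const_mul (-1))).deriv
      rw [hder] at this
      linarith
  have hcψ : ∀ x ∈ Ω, c x * ψ x = - deriv (u x) T - ellOp k ψ x + f x T := by
    intro x hx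
    have := hu.pde x hx T hT le_rfl
    rw [hψ]
    simp only
    linarith
  have key : ∀ n : ℕ, (∀ x ∈ Ω, 0 ≤ cs n x) ∧ (∀ x ∈ Ω, cs n x ≤ c x) ∧
      (∀ x ∈ Ω, cs n x ≤ cs (n + 1) x) := by
    intro n
    induction n with
    | zero =>
      refine ⟨fun x hx => (hinit0 x hx).ge, fun x hx => (hinit0 x hx).le.trans (hc x hx),
        fun x hx => ?_⟩
      rw [hinit0 x hx]
      have e := hiter 0 x hx
      have p := (hsol 0).pde x hx T hT le_rfl
      rw [hinit0 x hx] at p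
      have l := h13 x hx
      have e2 : (fun y => us 0 y T - ψ y) = fun y => us 0 y T + (-1) * ψ y := by
        funext y
        ring
      rw [e2, aux_lin k _ ψ (-1) x (hkd x hx) (aux_slice (hregs2 0) T)
        (by rw [hψ]; exact aux_slice hureg2 T)] at l
      have : 0 ≤ cs (0 + 1) x * ψ x := by linarith
      exact nonneg_of_mul_nonneg_left this (hψpos x hx)
    | succ n ih =>
      obtain ⟨i1, i2, i3⟩ := ih
      have j1 : ∀ x ∈ Ω, 0 ≤ cs (n + 1) x := fun x hx => (i1 x hx).trans (i3 x hx)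
      refine ⟨j1, fun x hx => ?_, fun x hx => ?_⟩
      · have := (comp _ _ _ _ (hregs2 n) hureg2 (hsol n) hu i1 i2).2 x hx
        have e := hiter n x hx
        have e' := hcψ x hx
        exact le_of_mul_le_mul_right (by linarith) (hψpos x hx)
      · have := (comp _ _ _ _ (hregs2 n) (hregs2 (n + 1)) (hsol n) (hsol (n + 1)) i1 i3).2 x hx
        have e := hiter n x hx
        have e' := hiter (n + 1) x hx
        exact le_of_mul_le_mul_right (by linarith) (hψpos x hx)
  intro n hn x hx
  obtain ⟨m, rfl⟩ : ∃ m, n = m + 1 := ⟨n - 1, by omega⟩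
  rw [Nat.add_sub_cancel]
  refine ⟨fun t ht htT => ⟨?_, ?_⟩, (key (m + 1)).2.1 x hx, (key m).2.2 x hx⟩
  · exact (comp _ _ _ _ (hregs2 (m + 1)) hureg2 (hsol (m + 1)) hu (key (m + 1)).1
      (key (m + 1)).2.1).1 x hx t ht.le htT
  · exact (comp _ _ _ _ (hregs2 m) (hregs2 (m + 1)) (hsol m) (hsol (m + 1)) (key m).1
      (key m).2.2).1 x hx t ht.le htT

end
end
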